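/- Define K(1) = 0 and K(n) = (1/log n)·Σ_{d | n} Λ(d)·Λ(n/d) for integers n ≥ 2. Then K(n) ≥ 0 for all n ≥ 1, and Σ_{n ≤ x} (Λ(n) + K(n)) = 2·x + O(x/log x) as x → ∞, where the sum runs over positive integers n ≤ x. -/

import Mathlib

open Filter Real Finset ArithmeticFunction

lemma log_sub_log_le_div_sub_one {a b : ℝ} (ha : 0 < a) (hb : 0 < b) :
    Real.log a - Real.log b ≤ a / b - 1 := by
  rw [← Real.log_div ha.ne' hb.ne']
  exact Real.log_le_sub_one_of_pos (div_pos ha hb)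

lemma mul_log_sub_log_le {a b : ℝ} (ha : 0 < a) (hb : 0 < b) :
    b * (Real.log a - Real.log b) ≤ a - b := by
  have h := mul_le_mul_of_nonneg_left (log_sub_log_le_div_sub_one ha hb) hb.le
  rwa [mul_sub b (a / b), mul_div_cancel₀ _ hb.ne', mul_one] at h

lemma sub_le_mul_log_sub_log {a b : ℝ} (ha : 0 < a) (hb : 0 < b) :
    a - b ≤ a * (Real.log a - Real.log b) := by
  linarith [mul_log_sub_log_le hb ha]

lemma le_sum_Ioc_log (N : ℕ) :
    N * Real.log N - N ≤ ∑ n ∈ Ioc 0 N, Real.log n := by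
  induction N with
  | zero => simp
  | succ N ih =>
    rw [sum_Ioc_succ_top (Nat.zero_le N)]
    rcases Nat.eq_zero_or_pos N with rfl | hN
    · simp
    · have hN' : (0 : ℝ) < N := by exact_mod_cast hN
      have := mul_log_sub_log_le (a := (N : ℝ) + 1) (by positivity) hN'
      push_cast
      linarith

lemma sum_Ioc_log_le {N : ℕ} (hN : 1 ≤ N) :
    ∑ n ∈ Ioc 0 N, Real.log n ≤ N * Real.log N - N + 1 + Real.log N := by
  induction N, hN using Nat.le_induction with
  | base => simp
  | succ N hN ih =>
    rw [sum_Ioc_succ_top (Nat.zero_le N)]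
    have hN' : (0 : ℝ) < N := by exact_mod_cast hN
    have := sub_le_mul_log_sub_log (a := (N : ℝ) + 1) (by positivity) hN'
    push_cast
    linarith

lemma abs_sum_log_sub_le {x : ℝ} (hx : 1 ≤ x) :
    |∑ n ∈ Ioc 0 ⌊x⌋₊, Real.log n - (x * Real.log x - x)| ≤ 1 + Real.log x := by
  have hN : 1 ≤ ⌊x⌋₊ := Nat.one_le_floor_iff _ |>.2 hx
  have h0 : (1 : ℝ) ≤ ⌊x⌋₊ := by exact_mod_cast hN
  have h1 := Nat.floor_le (zero_le_one.trans hx)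
  have h2 := (Nat.lt_floor_add_one x).le
  have l1 := le_sum_Ioc_log ⌊x⌋₊
  have l2 := sum_Ioc_log_le hN
  generalize (⌊x⌋₊ : ℝ) = N at *
  generalize ∑ n ∈ Ioc 0 ⌊x⌋₊, Real.log n = T at *
  have m1 := mul_log_sub_log_le (a := x) (b := N) (by linarith) (by linarith)
  have m2 := sub_le_mul_log_sub_log (a := x) (b := N) (by linarith) (by linarith)
  have p1 : (x - N) * Real.log x ≤ 1 * Real.log x :=
    mul_le_mul_of_nonneg_right (by linarith) (Real.log_nonneg hx)
  have p2 : 0 ≤ (x - N) * Real.log N := mul_nonneg (by linarith) (Real.log_nonneg h0)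
  have p3 : Real.log N ≤ Real.log x := Real.log_le_log (by linarith) h1
  rw [abs_le]
  constructor <;> linarith

lemma abs_sum_inv_sub_le {x : ℝ} (hx : 1 ≤ x) :
    |∑ n ∈ Ioc 0 ⌊x⌋₊, (n : ℝ)⁻¹ - (Real.log x + eulerMascheroniConstant)| ≤ 2 / x := by
  have hN : 1 ≤ ⌊x⌋₊ := Nat.one_le_floor_iff _ |>.2 hx
  have h0 : (1 : ℝ) ≤ ⌊x⌋₊ := by exact_mod_cast hN
  have h1 := Nat.floor_le (zero_le_one.trans hx)
  have h2 := (Nat.lt_floor_add_one x).le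
  have e : ∑ n ∈ Ioc 0 ⌊x⌋₊, (n : ℝ)⁻¹ = harmonic ⌊x⌋₊ := by
    rw [harmonic_eq_sum_Icc]
    push_cast
    rfl
  have l1 := eulerMascheroniSeq_lt_eulerMascheroniConstant ⌊x⌋₊
  have l2 := eulerMascheroniConstant_lt_eulerMascheroniSeq' ⌊x⌋₊
  rw [eulerMascheroniSeq] at l1
  rw [eulerMascheroniSeq', if_neg (by omega)] at l2
  rw [e]
  generalize (⌊x⌋₊ : ℝ) = N at *
  have p2 : Real.log x ≤ Real.log (N + 1) := Real.log_le_log (by linarith) h2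
  have p3 : Real.log N ≤ Real.log x := Real.log_le_log (by linarith) h1
  have m := log_sub_log_le_div_sub_one (a := N + 1) (b := N) (by linarith) (by linarith)
  have q : (N + 1) / N - 1 ≤ 2 / x := by
    rw [add_div, div_self (by linarith), add_sub_cancel_left,
      div_le_div_iff₀ (by linarith) (by linarith)]
    linarith
  rw [abs_le]
  constructor <;> linarith

lemma sum_Ioc_inv_sqrt_le (N : ℕ) : ∑ n ∈ Ioc 0 N, (√n)⁻¹ ≤ 2 * √N := by
  induction N with
  | zero => simp
  | succ N ih =>
    rw [sum_Ioc_succ_top (Nat.zero_le N)]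
    have h1 : 0 ≤ √(N : ℝ) := sqrt_nonneg _
    have h2 : 0 < √((N + 1 : ℕ) : ℝ) := sqrt_pos.2 (by positivity)
    have e1 := sq_sqrt (Nat.cast_nonneg (α := ℝ) N)
    have e2 := sq_sqrt (Nat.cast_nonneg (α := ℝ) (N + 1))
    push_cast at e2
    have : (√((N + 1 : ℕ) : ℝ))⁻¹ ≤ 2 * √((N + 1 : ℕ) : ℝ) - 2 * √(N : ℝ) := by
      rw [inv_le_iff_one_le_mul₀ h2]
      push_cast at *
      nlinarith [sq_nonneg (√((N : ℝ) + 1) - √N)]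
    linarith

lemma sum_Ioc_sqrt_div_le {x : ℝ} (hx : 0 ≤ x) :
    ∑ n ∈ Ioc 0 ⌊x⌋₊, √(x / n) ≤ 2 * x := by
  calc ∑ n ∈ Ioc 0 ⌊x⌋₊, √(x / n) = √x * ∑ n ∈ Ioc 0 ⌊x⌋₊, (√n)⁻¹ := by
        rw [mul_sum]
        exact sum_congr rfl fun n _ => by rw [sqrt_div hx, div_eq_mul_inv]
    _ ≤ √x * (2 * √x) := by
        gcongr
        exact (sum_Ioc_inv_sqrt_le _).trans (by gcongr; exact Nat.floor_le hx)
    _ = 2 * x := by rw [mul_left_comm, mul_self_sqrt hx]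

lemma log_sq_le_sqrt {x : ℝ} (hx : 1 ≤ x) : Real.log x ^ 2 ≤ 16 * √x := by
  have h0 := Real.log_nonneg hx
  have h : Real.log x ≤ 4 * √(√x) := by
    have := Real.log_le_self (sqrt_nonneg √x)
    rw [Real.log_sqrt (sqrt_nonneg x), Real.log_sqrt (by linarith)] at this
    linarith
  calc Real.log x ^ 2 ≤ (4 * √(√x)) ^ 2 := by gcongr
    _ = 16 * √x := by rw [mul_pow, sq_sqrt (sqrt_nonneg x)]; norm_num

lemma log_le_two_mul_sqrt {x : ℝ} (hx : 0 ≤ x) : Real.log x ≤ 2 * √x := by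
  have := Real.log_le_self (sqrt_nonneg x)
  rw [Real.log_sqrt hx] at this
  linarith

lemma sum_Ioc_sum_Ioc_div {M : Type*} [AddCommMonoid M] (f : ℕ → ℕ → M) (N : ℕ) :
    ∑ d ∈ Ioc 0 N, ∑ m ∈ Ioc 0 (N / d), f d m =
      ∑ k ∈ Ioc 0 N, ∑ p ∈ k.divisorsAntidiagonal, f p.1 p.2 := by
  rw [sum_sigma', sum_sigma']
  refine sum_bij' (fun a _ => ⟨a.1 * a.2, (a.1, a.2)⟩) (fun b _ => ⟨b.2.1, b.2.2⟩) ?_ ?_ ?_ ?_ ?_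
  · rintro ⟨d, m⟩ h
    simp only [mem_sigma, mem_Ioc, Nat.mem_divisorsAntidiagonal] at h ⊢
    obtain ⟨⟨h1, h2⟩, h3, h4⟩ := h
    refine ⟨⟨by positivity, ?_⟩, trivial, by positivity⟩
    rw [mul_comm]
    exact (Nat.le_div_iff_mul_le h1).1 h4
  · rintro ⟨k, d, m⟩ h
    simp only [mem_sigma, mem_Ioc, Nat.mem_divisorsAntidiagonal] at h ⊢
    obtain ⟨⟨h1, h2⟩, rfl, h4⟩ := h
    have hd := Nat.pos_of_mul_pos_right h1
    have hm := Nat.pos_of_mul_pos_left h1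
    refine ⟨⟨by assumption, ?_⟩, by assumption, ?_⟩
    · nlinarith
    · rw [Nat.le_div_iff_mul_le (by assumption)]
      linarith
  · rintro ⟨d, m⟩ h; rfl
  · rintro ⟨k, d, m⟩ h
    simp only [mem_sigma, mem_Ioc, Nat.mem_divisorsAntidiagonal] at h
    obtain ⟨-, rfl, -⟩ := h
    rfl
  · rintro ⟨d, m⟩ h; rfl

lemma sum_Ioc_mul_psi_div (a : ℕ → ℝ) (x : ℝ) :
    ∑ n ∈ Ioc 0 ⌊x⌋₊, a n * Chebyshev.psi (x / n) =
      ∑ k ∈ Ioc 0 ⌊x⌋₊, ∑ p ∈ k.divisorsAntidiagonal, a p.1 * Λ p.2 := by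
  simp_rw [← sum_Ioc_sum_Ioc_div (fun d m => a d * Λ m), Chebyshev.psi, Nat.floor_div_natCast,
    mul_sum]

lemma sum_Ioc_psi_div (x : ℝ) :
    ∑ n ∈ Ioc 0 ⌊x⌋₊, Chebyshev.psi (x / n) = ∑ n ∈ Ioc 0 ⌊x⌋₊, Real.log n := by
  have h := sum_Ioc_mul_psi_div (fun _ => 1) x
  simp only [one_mul] at h
  rw [h]
  refine sum_congr rfl fun k _ => ?_
  rw [Nat.sum_divisorsAntidiagonal' (fun _ j => Λ j), vonMangoldt_sum]

lemma sum_moebius_mul_log_div {x : ℝ} (hx : 0 < x) (k : ℕ) :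
    ∑ p ∈ k.divisorsAntidiagonal, (moebius p.1 : ℝ) * Real.log (x / p.1) =
      (if k = 1 then Real.log x else 0) + Λ k := by
  rw [Nat.sum_divisorsAntidiagonal (fun i _ => (moebius i : ℝ) * Real.log (x / i))]
  have h : ∀ d ∈ k.divisors, (moebius d : ℝ) * Real.log (x / d) =
      (moebius d : ℝ) * Real.log x - (moebius d : ℝ) * Real.log d := by
    intro d hd
    have : (d : ℝ) ≠ 0 := by exact_mod_cast (Nat.pos_of_mem_divisors hd).ne'
    rw [Real.log_div hx.ne' this, mul_sub]
  have hs : ∑ d ∈ k.divisors, (moebius d : ℝ) * Real.log d = -Λ k := sum_moebius_mul_log_eq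
  rw [sum_congr rfl h, sum_sub_distrib, hs, ← sum_mul, ← Int.cast_sum,
    ← coe_mul_zeta_apply, moebius_mul_coe_zeta, one_apply]
  split_ifs <;> simp

/-- The Tatuzawa–Iseki identity. -/
lemma sum_moebius_mul_log_mul_sum (F : ℝ → ℝ) {x : ℝ} (hx : 1 ≤ x) :
    ∑ d ∈ Ioc 0 ⌊x⌋₊, (moebius d : ℝ) * Real.log (x / d) * ∑ m ∈ Ioc 0 ⌊x / d⌋₊, F (x / d / m) =
      F x * Real.log x + ∑ n ∈ Ioc 0 ⌊x⌋₊, Λ n * F (x / n) := by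
  simp_rw [Nat.floor_div_natCast, mul_sum]
  rw [sum_Ioc_sum_Ioc_div
    (fun d m => (moebius d : ℝ) * Real.log (x / d) * F (x / d / m))]
  have h : ∀ k ∈ Ioc 0 ⌊x⌋₊, ∑ p ∈ k.divisorsAntidiagonal,
      (moebius p.1 : ℝ) * Real.log (x / p.1) * F (x / p.1 / p.2) =
      (if k = 1 then F x * Real.log x else 0) + Λ k * F (x / k) := by
    intro k _
    have h' : ∀ p ∈ k.divisorsAntidiagonal,
        (moebius p.1 : ℝ) * Real.log (x / p.1) * F (x / p.1 / p.2) =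
        (moebius p.1 : ℝ) * Real.log (x / p.1) * F (x / k) := by
      intro p hp
      rw [← (Nat.mem_divisorsAntidiagonal.1 hp).1, div_div, Nat.cast_mul]
    rw [sum_congr rfl h', ← sum_mul, sum_moebius_mul_log_div (by linarith), add_mul]
    split_ifs with hk
    · rw [hk, Nat.cast_one, div_one, mul_comm (Real.log x)]
    · simp
  rw [sum_congr rfl h, sum_add_distrib, sum_ite_eq', if_pos]
  exact mem_Ioc.2 ⟨one_pos, Nat.one_le_floor_iff _ |>.2 hx⟩

/-- Mertens' first theorem for `Λ`. -/
lemma abs_mul_sum_vonMangoldt_div_sub_le {x : ℝ} (hx : 1 ≤ x) :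
    |x * ∑ n ∈ Ioc 0 ⌊x⌋₊, Λ n / n - x * Real.log x| ≤ (Real.log 4 + 6) * x := by
  have hx0 : 0 ≤ x := by linarith
  have e : ∑ n ∈ Ioc 0 ⌊x⌋₊, Real.log n = ∑ n ∈ Ioc 0 ⌊x⌋₊, Λ n * (⌊x / n⌋₊ : ℝ) := by
    have h := sum_Ioc_sum_Ioc_div (fun d _ => Λ d) ⌊x⌋₊
    simp only [sum_const, Nat.card_Ioc, tsub_zero, nsmul_eq_mul] at h
    simp_rw [Nat.floor_div_natCast, mul_comm (Λ _)]
    rw [h]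
    refine sum_congr rfl fun k _ => ?_
    rw [Nat.sum_divisorsAntidiagonal (fun j _ => Λ j), vonMangoldt_sum]
  have e2 : x * ∑ n ∈ Ioc 0 ⌊x⌋₊, Λ n / n = ∑ n ∈ Ioc 0 ⌊x⌋₊, Λ n * (x / n) := by
    rw [mul_sum]
    exact sum_congr rfl fun n _ => by ring
  have h1 : ∑ n ∈ Ioc 0 ⌊x⌋₊, Real.log n ≤ x * ∑ n ∈ Ioc 0 ⌊x⌋₊, Λ n / n := by
    rw [e, e2]
    gcongr with n
    exact Nat.floor_le (by positivity)
  have h2 : x * ∑ n ∈ Ioc 0 ⌊x⌋₊, Λ n / n ≤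
      ∑ n ∈ Ioc 0 ⌊x⌋₊, Real.log n + Chebyshev.psi x := by
    rw [e, e2, Chebyshev.psi, ← sum_add_distrib]
    gcongr with n
    rw [← mul_add_one]
    gcongr
    exact (Nat.lt_floor_add_one _).le
  have h3 := Chebyshev.psi_le_const_mul_self hx0
  have h4 := abs_le.1 (abs_sum_log_sub_le hx)
  have h5 := Real.log_le_sub_one_of_pos (show 0 < x by linarith)
  have h6 : 0 < Real.log 4 := Real.log_pos (by norm_num)
  have h7 : 0 ≤ Real.log 4 * x := by positivity
  rw [abs_le]
  constructor <;> linarith [h4.1, h4.2]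

lemma abs_sum_psi_div_sub_le {x : ℝ} (hx : 1 ≤ x) :
    |∑ n ∈ Ioc 0 ⌊x⌋₊, (Chebyshev.psi (x / n) - x / n + (eulerMascheroniConstant + 1))| ≤
      5 + Real.log x := by
  have hx0 : 0 < x := by linarith
  have e : ∑ n ∈ Ioc 0 ⌊x⌋₊, (x / (n : ℝ)) = x * ∑ n ∈ Ioc 0 ⌊x⌋₊, (n : ℝ)⁻¹ := by
    rw [mul_sum]
    rfl
  rw [sum_add_distrib, sum_sub_distrib, sum_Ioc_psi_div, e, sum_const, Nat.card_Ioc, tsub_zero,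
    nsmul_eq_mul]
  have h1 := abs_le.1 (abs_sum_log_sub_le hx)
  have h2 : |x * ∑ n ∈ Ioc 0 ⌊x⌋₊, (n : ℝ)⁻¹ -
      x * (Real.log x + eulerMascheroniConstant)| ≤ 2 := by
    rw [← mul_sub, abs_mul, abs_of_pos hx0]
    calc _ ≤ x * (2 / x) := by gcongr; exact abs_sum_inv_sub_le hx
      _ = 2 := mul_div_cancel₀ _ hx0.ne'
  have h3 := Nat.floor_le hx0.le
  have h4 := Nat.lt_floor_add_one x
  have h5 := one_half_lt_eulerMascheroniConstant
  have h6 := eulerMascheroniConstant_lt_two_thirds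
  have h7 : (x - ⌊x⌋₊) * (eulerMascheroniConstant + 1) ≤ 1 * 2 := by gcongr <;> linarith
  have h8 : 0 ≤ (x - ⌊x⌋₊) * (eulerMascheroniConstant + 1) :=
    mul_nonneg (by linarith) (by linarith)
  have h9 := abs_le.1 h2
  rw [abs_le]
  constructor <;> linarith [h1.1, h1.2, h9.1, h9.2]

lemma abs_psi_mul_log_add_sum_sub_le {x : ℝ} (hx : 1 ≤ x) :
    |(Chebyshev.psi x - x + (eulerMascheroniConstant + 1)) * Real.log x +
      ∑ n ∈ Ioc 0 ⌊x⌋₊, Λ n *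
        (Chebyshev.psi (x / n) - x / n + (eulerMascheroniConstant + 1))| ≤ 52 * x := by
  rw [← sum_moebius_mul_log_mul_sum
    (fun y => Chebyshev.psi y - y + (eulerMascheroniConstant + 1)) hx]
  refine (abs_sum_le_sum_abs _ _).trans ?_
  calc _ ≤ ∑ d ∈ Ioc 0 ⌊x⌋₊, 26 * √(x / d) := ?_
    _ = 26 * ∑ d ∈ Ioc 0 ⌊x⌋₊, √(x / d) := (mul_sum ..).symm
    _ ≤ 26 * (2 * x) := by gcongr; exact sum_Ioc_sqrt_div_le (by linarith)
    _ = 52 * x := by ring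
  refine sum_le_sum fun d hd => ?_
  obtain ⟨hd0, hd⟩ := mem_Ioc.1 hd
  have hd0' : (0 : ℝ) < d := by exact_mod_cast hd0
  have hdx : (1 : ℝ) ≤ x / d := by
    rw [one_le_div hd0']
    exact (Nat.le_floor_iff (by linarith)).1 hd
  have hl := Real.log_nonneg hdx
  have hμ : |(moebius d : ℝ)| ≤ 1 := by exact_mod_cast abs_moebius_le_one
  rw [abs_mul, abs_mul, abs_of_nonneg hl]
  calc _ ≤ 1 * Real.log (x / d) * (5 + Real.log (x / d)) := by
        gcongr
        exact abs_sum_psi_div_sub_le hdx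
    _ = 5 * Real.log (x / d) + Real.log (x / d) ^ 2 := by ring
    _ ≤ 5 * (2 * √(x / d)) + 16 * √(x / d) := by
        gcongr
        · exact log_le_two_mul_sqrt (by linarith)
        · exact log_sq_le_sqrt hdx
    _ = 26 * √(x / d) := by ring

lemma sum_mul_log_div_le {a : ℕ → ℝ} (ha : ∀ n, 0 ≤ a n) {C : ℝ} (hC : 0 ≤ C)
    (h : ∀ N : ℕ, ∑ n ∈ Ioc 0 N, a n ≤ C * N) {x : ℝ} (hx : 1 ≤ x) :
    ∑ n ∈ Ioc 0 ⌊x⌋₊, a n * Real.log (x / n) ≤ C * x := by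
  have key : ∀ N : ℕ, ∑ n ∈ Ioc 0 N, a n * (Real.log (N + 1) - Real.log n) ≤ C * N := by
    intro N
    induction N with
    | zero => simp
    | succ N ih =>
      have hN : (0 : ℝ) < N + 1 := by positivity
      have e : ∑ n ∈ Ioc 0 (N + 1), a n * (Real.log ((N + 1 : ℕ) + 1) - Real.log n) =
          ∑ n ∈ Ioc 0 N, a n * (Real.log (N + 1) - Real.log n) +
          (∑ n ∈ Ioc 0 (N + 1), a n) * (Real.log (N + 1 + 1) - Real.log (N + 1)) := by
        simp only [sum_Ioc_succ_top (Nat.zero_le N), add_mul, sum_mul]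
        rw [← add_assoc, ← sum_add_distrib]
        push_cast
        congr 1
        exact sum_congr rfl fun n _ => by ring
      have h1 : Real.log (N + 1 + 1) - Real.log (N + 1) ≤ 1 / ((N : ℝ) + 1) := by
        refine (log_sub_log_le_div_sub_one (by positivity) hN).trans_eq ?_
        field_simp
        ring
      have h2 : 0 ≤ Real.log ((N : ℝ) + 1 + 1) - Real.log (N + 1) :=
        sub_nonneg.2 (Real.log_le_log hN (by linarith))
      have h3 : (∑ n ∈ Ioc 0 (N + 1), a n) * (Real.log (N + 1 + 1) - Real.log (N + 1)) ≤
          (C * (N + 1 : ℕ)) * (1 / ((N : ℝ) + 1)) := by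
        gcongr
        exact h (N + 1)
      have h4 : (C * (N + 1 : ℕ)) * (1 / ((N : ℝ) + 1)) = C := by
        push_cast
        field_simp
      rw [e]
      push_cast
      linarith
  calc _ ≤ ∑ n ∈ Ioc 0 ⌊x⌋₊, a n * (Real.log (⌊x⌋₊ + 1) - Real.log n) := by
        refine sum_le_sum fun n hn => mul_le_mul_of_nonneg_left ?_ (ha n)
        have hn0 : (n : ℝ) ≠ 0 := by exact_mod_cast (mem_Ioc.1 hn).1.ne'
        rw [Real.log_div (by linarith) hn0]
        gcongr
        exact (Nat.lt_floor_add_one x).le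
    _ ≤ C * ⌊x⌋₊ := key _
    _ ≤ C * x := by gcongr; exact Nat.floor_le (by linarith)

/-- The arithmetic function `Λ · log + Λ * Λ` in Selberg's symmetry formula. -/
noncomputable def selbergLambda (n : ℕ) : ℝ :=
  Λ n * Real.log n + ∑ p ∈ n.divisorsAntidiagonal, Λ p.1 * Λ p.2

lemma selbergLambda_nonneg (n : ℕ) : 0 ≤ selbergLambda n :=
  add_nonneg (mul_nonneg vonMangoldt_nonneg (Real.log_natCast_nonneg n))
    (sum_nonneg fun _ _ => mul_nonneg vonMangoldt_nonneg vonMangoldt_nonneg)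

lemma selbergLambda_le (n : ℕ) : selbergLambda n ≤ 2 * Real.log n ^ 2 := by
  have hl := Real.log_natCast_nonneg n
  have h1 : Λ n * Real.log n ≤ Real.log n * Real.log n := by
    gcongr
    exact vonMangoldt_le_log
  have h2 : ∑ p ∈ n.divisorsAntidiagonal, Λ p.1 * Λ p.2 ≤
      ∑ p ∈ n.divisorsAntidiagonal, Λ p.1 * Real.log n := by
    refine sum_le_sum fun p hp => mul_le_mul_of_nonneg_left ?_ vonMangoldt_nonneg
    obtain ⟨rfl, hn⟩ := Nat.mem_divisorsAntidiagonal.1 hp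
    refine vonMangoldt_le_log.trans (Real.log_le_log ?_ ?_)
    · exact_mod_cast Nat.pos_of_ne_zero (right_ne_zero_of_mul hn)
    · exact_mod_cast Nat.le_mul_of_pos_left _ (Nat.pos_of_ne_zero (left_ne_zero_of_mul hn))
  have h3 : ∑ p ∈ n.divisorsAntidiagonal, Λ p.1 * Real.log n = Real.log n * Real.log n := by
    rw [Nat.sum_divisorsAntidiagonal (fun i _ => Λ i * Real.log n), ← sum_mul, vonMangoldt_sum]
  rw [selbergLambda, sq]
  linarith

/-- Selberg's symmetry formula. -/
lemma exists_abs_sum_selbergLambda_sub_le :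
    ∃ C : ℝ, 0 ≤ C ∧ ∀ x : ℝ, 1 ≤ x →
      |∑ n ∈ Ioc 0 ⌊x⌋₊, selbergLambda n - 2 * x * Real.log x| ≤ C * x := by
  have hl4 : 0 < Real.log 4 := Real.log_pos (by norm_num)
  refine ⟨52 + 2 + 2 * (Real.log 4 + 6) + 3 * (Real.log 4 + 4), by positivity, fun x hx => ?_⟩
  have hx0 : 0 < x := by linarith
  have h1 := abs_psi_mul_log_add_sum_sub_le hx
  have h2 := abs_mul_sum_vonMangoldt_div_sub_le hx
  have h3 : ∑ n ∈ Ioc 0 ⌊x⌋₊, Λ n * Real.log (x / n) ≤ (Real.log 4 + 4) * x := by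
    refine sum_mul_log_div_le (fun _ => vonMangoldt_nonneg) (by positivity) (fun N => ?_) hx
    simpa [Chebyshev.psi] using Chebyshev.psi_le_const_mul_self (Nat.cast_nonneg (α := ℝ) N)
  have h4 : 0 ≤ ∑ n ∈ Ioc 0 ⌊x⌋₊, Λ n * Real.log (x / n) := by
    refine sum_nonneg fun n hn => mul_nonneg vonMangoldt_nonneg (Real.log_nonneg ?_)
    obtain ⟨hn0, hn⟩ := mem_Ioc.1 hn
    rw [one_le_div (by exact_mod_cast hn0)]
    exact (Nat.le_floor_iff hx0.le).1 hn
  have e1 : ∑ n ∈ Ioc 0 ⌊x⌋₊, Λ n * Real.log (x / n) =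
      Chebyshev.psi x * Real.log x - ∑ n ∈ Ioc 0 ⌊x⌋₊, Λ n * Real.log n := by
    rw [Chebyshev.psi, sum_mul, ← sum_sub_distrib]
    refine sum_congr rfl fun n hn => ?_
    have hn0 : (n : ℝ) ≠ 0 := by exact_mod_cast (mem_Ioc.1 hn).1.ne'
    rw [Real.log_div hx0.ne' hn0, mul_sub]
  have e2 : ∑ n ∈ Ioc 0 ⌊x⌋₊, Λ n *
      (Chebyshev.psi (x / n) - x / n + (eulerMascheroniConstant + 1)) =
      ∑ n ∈ Ioc 0 ⌊x⌋₊, Λ n * Chebyshev.psi (x / n) - x * ∑ n ∈ Ioc 0 ⌊x⌋₊, Λ n / n +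
      Chebyshev.psi x * (eulerMascheroniConstant + 1) := by
    rw [Chebyshev.psi, sum_mul, mul_sum, ← sum_sub_distrib, ← sum_add_distrib]
    exact sum_congr rfl fun n _ => by ring
  have e3 : ∑ n ∈ Ioc 0 ⌊x⌋₊, selbergLambda n = ∑ n ∈ Ioc 0 ⌊x⌋₊, Λ n * Real.log n +
      ∑ n ∈ Ioc 0 ⌊x⌋₊, Λ n * Chebyshev.psi (x / n) := by
    rw [sum_Ioc_mul_psi_div, ← sum_add_distrib]
    rfl
  rw [e1] at h3 h4
  rw [e2] at h1
  rw [e3]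
  have h5 := Chebyshev.psi_nonneg x
  have h6 := Chebyshev.psi_le_const_mul_self hx0.le
  have h7 := one_half_lt_eulerMascheroniConstant
  have h8 := eulerMascheroniConstant_lt_two_thirds
  have h9 : Chebyshev.psi x * (eulerMascheroniConstant + 1) ≤ (Real.log 4 + 4) * x * 2 := by
    gcongr
    linarith
  have h10 : 0 ≤ Chebyshev.psi x * (eulerMascheroniConstant + 1) := by positivity
  have h11 := Real.log_nonneg hx
  have h12 : (eulerMascheroniConstant + 1) * Real.log x ≤ 2 * x := by
    gcongr
    · linarith
    · exact Real.log_le_self hx0.le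
  have h13 : 0 ≤ (eulerMascheroniConstant + 1) * Real.log x := by positivity
  have h14 : 0 ≤ Real.log 4 * x := by positivity
  rw [abs_le] at h1 h2 ⊢
  constructor <;> linarith [h1.1, h1.2, h2.1, h2.2]

lemma selbergLambda_div_log_mul_log (n : ℕ) :
    selbergLambda n / Real.log n * Real.log n = selbergLambda n := by
  refine div_mul_cancel_of_imp fun h => le_antisymm ?_ (selbergLambda_nonneg n)
  simpa [h] using selbergLambda_le n

lemma sum_selbergLambda_div_log_mul_log {x : ℝ} (hx : 1 ≤ x) :
    (∑ n ∈ Ioc 0 ⌊x⌋₊, selbergLambda n / Real.log n) * Real.log x =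
      ∑ n ∈ Ioc 0 ⌊x⌋₊, selbergLambda n +
      ∑ n ∈ Ioc 0 ⌊x⌋₊, selbergLambda n / Real.log n * Real.log (x / n) := by
  rw [sum_mul, ← sum_add_distrib]
  refine sum_congr rfl fun n hn => ?_
  have hn0 : (n : ℝ) ≠ 0 := by exact_mod_cast (mem_Ioc.1 hn).1.ne'
  rw [Real.log_div (by linarith) hn0, mul_sub, selbergLambda_div_log_mul_log]
  ring

lemma selbergLambda_div_log_nonneg (n : ℕ) : 0 ≤ selbergLambda n / Real.log n :=
  div_nonneg (selbergLambda_nonneg n) (Real.log_natCast_nonneg n)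

lemma selbergLambda_div_log_le (n : ℕ) : selbergLambda n / Real.log n ≤ 2 * Real.log n :=
  div_le_of_le_mul₀ (Real.log_natCast_nonneg n) (by linarith [Real.log_natCast_nonneg n])
    ((selbergLambda_le n).trans_eq (by ring))

lemma exists_sum_selbergLambda_div_log_le :
    ∃ C : ℝ, 0 ≤ C ∧ ∀ N : ℕ, ∑ n ∈ Ioc 0 N, selbergLambda n / Real.log n ≤ C * N := by
  obtain ⟨C, hC, h⟩ := exists_abs_sum_selbergLambda_sub_le
  have hl2 : 0 < Real.log 2 := Real.log_pos (by norm_num)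
  refine ⟨4 + C / Real.log 2, by positivity, fun N => ?_⟩
  rcases lt_or_ge N 2 with hN | hN
  · interval_cases N
    · simp
    · simp
      positivity
  have hN2 : (2 : ℝ) ≤ N := by exact_mod_cast hN
  have hN1 : (1 : ℝ) ≤ N := by linarith
  have hlog : Real.log 2 ≤ Real.log N := Real.log_le_log (by norm_num) hN2
  have h1 := (abs_le.1 (h N hN1)).2
  have h2 := sum_selbergLambda_div_log_mul_log hN1
  have h3 := sum_mul_log_div_le (a := fun _ => 1) (fun _ => zero_le_one) zero_le_one
    (fun N => by simp) hN1
  rw [Nat.floor_natCast] at h1 h2 h3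
  have h4 : ∑ n ∈ Ioc 0 N, selbergLambda n / Real.log n * Real.log (N / n) ≤
      2 * Real.log N * ∑ n ∈ Ioc 0 N, 1 * Real.log ((N : ℝ) / n) := by
    rw [mul_sum]
    refine sum_le_sum fun n hn => ?_
    obtain ⟨hn0, hn⟩ := mem_Ioc.1 hn
    have hn0' : (0 : ℝ) < n := by exact_mod_cast hn0
    have hn' : (n : ℝ) ≤ N := by exact_mod_cast hn
    rw [one_mul]
    have : 0 ≤ Real.log (N / n) := Real.log_nonneg ((one_le_div hn0').2 hn')
    gcongr
    exact (selbergLambda_div_log_le n).trans (by gcongr)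
  have h5 : 2 * Real.log N * ∑ n ∈ Ioc 0 N, 1 * Real.log ((N : ℝ) / n) ≤
      2 * Real.log N * (1 * N) := by gcongr
  have h6 : C * N ≤ C / Real.log 2 * N * Real.log N := by
    calc C * N = C / Real.log 2 * N * Real.log 2 := by field_simp
      _ ≤ _ := by gcongr
  refine le_of_mul_le_mul_right ?_ (hl2.trans_le hlog)
  linarith

lemma exists_abs_sum_selbergLambda_div_log_sub_le :
    ∃ C : ℝ, ∀ x : ℝ, 2 ≤ x →
      |∑ n ∈ Ioc 0 ⌊x⌋₊, selbergLambda n / Real.log n - 2 * x| ≤ C * (x / Real.log x) := by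
  obtain ⟨C, hC, h⟩ := exists_abs_sum_selbergLambda_sub_le
  obtain ⟨D, hD, h'⟩ := exists_sum_selbergLambda_div_log_le
  refine ⟨C + D, fun x hx => ?_⟩
  have hx1 : 1 ≤ x := by linarith
  have hlog : 0 < Real.log x := Real.log_pos (by linarith)
  have h1 := abs_le.1 (h x hx1)
  have h2 := sum_selbergLambda_div_log_mul_log hx1
  have h3 := sum_mul_log_div_le selbergLambda_div_log_nonneg hD h' hx1
  have h4 : 0 ≤ ∑ n ∈ Ioc 0 ⌊x⌋₊, selbergLambda n / Real.log n * Real.log (x / n) := by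
    refine sum_nonneg fun n hn => mul_nonneg (selbergLambda_div_log_nonneg n) (Real.log_nonneg ?_)
    obtain ⟨hn0, hn⟩ := mem_Ioc.1 hn
    rw [one_le_div (by exact_mod_cast hn0)]
    exact (Nat.le_floor_iff (by linarith)).1 hn
  have h5 : 0 ≤ D * x := by positivity
  rw [← mul_div_assoc, le_div_iff₀ hlog, ← abs_of_pos hlog, ← abs_mul, abs_le]
  constructor <;> linarith [h1.1, h1.2]

/-- The Selberg / Erdős–Karamata estimate. -/
theorem selberg_erdos_karamata
    (K : ℕ → ℝ) (hK1 : K 1 = 0)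
    (hKn : ∀ n : ℕ, 2 ≤ n →
      K n = (1 / Real.log n) * ∑ d ∈ n.divisors, Λ d * Λ (n / d)) :
    (∀ n : ℕ, 1 ≤ n → 0 ≤ K n) ∧
    ((fun x : ℝ => (∑ n ∈ Finset.Icc 1 ⌊x⌋₊, (Λ n + K n)) - 2 * x)
      =O[atTop] fun x : ℝ => x / Real.log x) := by
  constructor
  · intro n hn
    rcases hn.eq_or_lt with rfl | hn
    · exact hK1.ge
    · rw [hKn n hn]
      exact mul_nonneg (one_div_nonneg.2 (Real.log_natCast_nonneg n))
        (sum_nonneg fun _ _ => mul_nonneg vonMangoldt_nonneg vonMangoldt_nonneg)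
  · obtain ⟨C, hC⟩ := exists_abs_sum_selbergLambda_div_log_sub_le
    refine Asymptotics.IsBigO.of_bound C ?_
    filter_upwards [eventually_ge_atTop 2] with x hx
    have hlog : 0 < Real.log x := Real.log_pos (by linarith)
    have e : ∑ n ∈ Icc 1 ⌊x⌋₊, (Λ n + K n) =
        ∑ n ∈ Ioc 0 ⌊x⌋₊, selbergLambda n / Real.log n := by
      refine sum_congr rfl fun n hn => ?_
      rcases (mem_Icc.1 hn).1.eq_or_lt with rfl | hn
      · simp [hK1]
      · have hl : Real.log n ≠ 0 := (Real.log_pos (by exact_mod_cast hn)).ne'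
        rw [hKn n hn, selbergLambda,
          Nat.sum_divisorsAntidiagonal (fun i j => Λ i * Λ j)]
        field_simp
    rw [e, Real.norm_eq_abs, Real.norm_of_nonneg (by positivity)]
    exact hC x hx
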